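/- arXiv:2305.15671 — 6 statements merged into one kernel-verified Lean document; each statement's English description precedes it below -/
import Mathlib

section
/- Let Σ be an invertible real D×D matrix, K a real S×S matrix, and λ ≠ 0 a real number such that Σ ⊗ K + λ·I_{SD} is invertible. Then Σ ⊗ I_S + λ⁻¹·Σ² ⊗ K is invertible and (I_D ⊗ K)·(Σ ⊗ K + λ·I_{SD})⁻¹ = (Σ ⊗ I_S)⁻¹ − (Σ ⊗ I_S + λ⁻¹·Σ² ⊗ K)⁻¹. -/
open Kronecker

/-- If `A` and `B` commute and `A` and `A * B + c • 1` are invertible, then so is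
`A + c⁻¹ • (A * A * B)`, and its inverse is `A⁻¹ - B * (A * B + c • 1)⁻¹`. -/
theorem Matrix.mul_inv_mul_add_smul_one {n R : Type*} [Fintype n] [DecidableEq n] [Field R]
    {A B : Matrix n n R} (hAB : Commute A B) (hA : IsUnit A) {c : R} (hc : c ≠ 0)
    (hM : IsUnit (A * B + c • (1 : Matrix n n R))) :
    IsUnit (A + c⁻¹ • (A * A * B)) ∧
      B * (A * B + c • (1 : Matrix n n R))⁻¹ = A⁻¹ - (A + c⁻¹ • (A * A * B))⁻¹ := by
  set M := A * B + c • (1 : Matrix n n R) with hMdef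
  have hAdet := (Matrix.isUnit_iff_isUnit_det A).mp hA
  have hMdet := (Matrix.isUnit_iff_isUnit_det M).mp hM
  have hN : A + c⁻¹ • (A * A * B) = c⁻¹ • (M * A) := by
    rw [hMdef, add_mul, smul_add, smul_mul_assoc, one_mul, inv_smul_smul₀ hc, mul_assoc A B A,
      ← hAB.eq, ← mul_assoc, add_comm]
  have hleft : (c • (A⁻¹ * M⁻¹)) * (A + c⁻¹ • (A * A * B)) = 1 := by
    rw [hN, smul_mul_smul_comm, mul_inv_cancel₀ hc, one_smul, mul_assoc,
      Matrix.nonsing_inv_mul_cancel_left _ _ hMdet, Matrix.nonsing_inv_mul _ hAdet]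
  refine ⟨IsUnit.of_mul_eq_one_right _ hleft, ?_⟩
  have hB : B = A⁻¹ * (M - c • 1) := by
    rw [hMdef, add_sub_cancel_right, Matrix.nonsing_inv_mul_cancel_left _ _ hAdet]
  rw [Matrix.inv_eq_left_inv hleft]
  calc B * M⁻¹ = A⁻¹ * (M - c • 1) * M⁻¹ := by rw [← hB]
    _ = A⁻¹ - c • (A⁻¹ * M⁻¹) := by
      rw [mul_assoc, sub_mul, Matrix.mul_nonsing_inv _ hMdet, smul_mul_assoc, one_mul, mul_sub,
        mul_one, mul_smul_comm]

/-- For an invertible real `D×D` matrix `Σ`, a real `S×S` matrix `K` and `λ ≠ 0` such that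
`Σ ⊗ K + λ I_{SD}` is invertible, the matrix `Σ ⊗ I_S + λ⁻¹ Σ² ⊗ K` is invertible and
`(I_D ⊗ K)(Σ ⊗ K + λ I)⁻¹ = (Σ ⊗ I_S)⁻¹ − (Σ ⊗ I_S + λ⁻¹ Σ² ⊗ K)⁻¹`. -/
theorem stmt_8 {D S : ℕ} (Sig : Matrix (Fin D) (Fin D) ℝ) (hSig : IsUnit Sig)
    (K : Matrix (Fin S) (Fin S) ℝ) (lam : ℝ) (hlam : lam ≠ 0)
    (hinv : IsUnit (Sig ⊗ₖ K + lam • (1 : Matrix (Fin D × Fin S) (Fin D × Fin S) ℝ))) :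
    IsUnit (Sig ⊗ₖ (1 : Matrix (Fin S) (Fin S) ℝ) + lam⁻¹ • ((Sig * Sig) ⊗ₖ K)) ∧
    ((1 : Matrix (Fin D) (Fin D) ℝ) ⊗ₖ K)
        * (Sig ⊗ₖ K + lam • (1 : Matrix (Fin D × Fin S) (Fin D × Fin S) ℝ))⁻¹ =
      (Sig ⊗ₖ (1 : Matrix (Fin S) (Fin S) ℝ))⁻¹
        - (Sig ⊗ₖ (1 : Matrix (Fin S) (Fin S) ℝ) + lam⁻¹ • ((Sig * Sig) ⊗ₖ K))⁻¹ := by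
  have hcomm : Commute (Sig ⊗ₖ (1 : Matrix (Fin S) (Fin S) ℝ))
      ((1 : Matrix (Fin D) (Fin D) ℝ) ⊗ₖ K) := by
    simp [Commute, SemiconjBy, ← Matrix.mul_kronecker_mul]
  have hunit : IsUnit (Sig ⊗ₖ (1 : Matrix (Fin S) (Fin S) ℝ)) := by
    rw [Matrix.isUnit_iff_isUnit_det] at hSig ⊢
    simpa [Matrix.det_kronecker] using hSig.pow S
  have key := fun h => Matrix.mul_inv_mul_add_smul_one hcomm hunit hlam h
  simp only [← Matrix.mul_kronecker_mul, mul_one, one_mul] at key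
  exact key hinv
end

section
/- Let K be a real S×S symmetric positive semidefinite matrix, Σ a real D×D symmetric positive definite matrix, and λ > 0. Then the SD×SD matrix (I_D ⊗ K)·(Σ ⊗ K + λ·I_{SD})⁻¹ is symmetric positive semidefinite. -/
open Kronecker

/-- For a real `S×S` symmetric positive semidefinite matrix `K`, a real `D×D` symmetric positive
definite matrix `Σ`, and `λ > 0`, the matrix `(I_D ⊗ K)(Σ ⊗ K + λ I_{SD})⁻¹` is symmetric
positive semidefinite. -/
theorem stmt_9 {D S : ℕ} (K : Matrix (Fin S) (Fin S) ℝ) (hK : K.PosSemidef)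
    (Sig : Matrix (Fin D) (Fin D) ℝ) (hSig : Sig.PosDef) (lam : ℝ) (hlam : 0 < lam) :
    (((1 : Matrix (Fin D) (Fin D) ℝ) ⊗ₖ K)
        * (Sig ⊗ₖ K + lam • (1 : Matrix (Fin D × Fin S) (Fin D × Fin S) ℝ))⁻¹).PosSemidef := by
  set M := Sig ⊗ₖ K + lam • (1 : Matrix (Fin D × Fin S) (Fin D × Fin S) ℝ) with hM
  have hMpos : M.PosDef :=
    Matrix.PosDef.posSemidef_add (hSig.posSemidef.kronecker hK) (Matrix.PosDef.one.smul hlam)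
  have hMA : (M * ((1 : Matrix (Fin D) (Fin D) ℝ) ⊗ₖ K)).PosSemidef := by
    have hKK : (K * K).PosSemidef := by
      have h := Matrix.posSemidef_conjTranspose_mul_self K
      rwa [hK.isHermitian.eq] at h
    have hexpand : M * ((1 : Matrix (Fin D) (Fin D) ℝ) ⊗ₖ K)
        = Sig ⊗ₖ (K * K) + lam • ((1 : Matrix (Fin D) (Fin D) ℝ) ⊗ₖ K) := by
      rw [hM, add_mul, ← Matrix.mul_kronecker_mul, mul_one, smul_mul_assoc, one_mul]
    rw [hexpand]
    exact (hSig.posSemidef.kronecker hKK).add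
      ((Matrix.PosSemidef.one.kronecker hK).smul hlam.le)
  have hconj := hMA.conjTranspose_mul_mul_same M⁻¹
  rwa [hMpos.inv.isHermitian.eq, ← mul_assoc,
    Matrix.nonsing_inv_mul _ ((Matrix.isUnit_iff_isUnit_det _).mp hMpos.isUnit), one_mul] at hconj
end

section
/- Let Z be a real T×D matrix, K a real S×S symmetric positive semidefinite matrix, λ > 0, T ≥ 1, and set W = (I_{TS} + (1/(λT))·(ZZᵀ) ⊗ K)⁻¹. Then for every vector γ ∈ ℝ^{SD}, γᵀ·(Zᵀ ⊗ K)·W·(Z ⊗ K)·γ ≤ λT · γᵀ(I_D ⊗ K)γ. -/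
open Matrix Kronecker

/-- For `G` positive semidefinite and `c > 0`, the quadratic form of
`G Aᵀ (1 + c⁻¹ A G Aᵀ)⁻¹ A G` is dominated by that of `c G`. -/
theorem dotProduct_regularized_inv_le {m n : Type*} [Fintype m] [Fintype n] [DecidableEq m]
    (A : Matrix m n ℝ) {G : Matrix n n ℝ} (hG : G.PosSemidef) {c : ℝ} (hc : 0 < c) (γ : n → ℝ) :
    γ ⬝ᵥ ((G * Aᵀ) * (1 + c⁻¹ • (A * G * Aᵀ))⁻¹ * (A * G)) *ᵥ γ ≤ c * (γ ⬝ᵥ G *ᵥ γ) := by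
  have hGt : Gᵀ = G := by simpa using hG.isHermitian.eq
  have hP : (1 + c⁻¹ • (A * G * Aᵀ)).PosDef := by
    refine PosDef.one.add_posSemidef (PosSemidef.smul ?_ (inv_nonneg.2 hc.le))
    simpa using hG.mul_mul_conjTranspose_same A
  set P := 1 + c⁻¹ • (A * G * Aᵀ) with hPdef
  set u := P⁻¹ *ᵥ (A * G) *ᵥ γ with hu
  set w := Aᵀ *ᵥ u with hw
  have hsymm : w ⬝ᵥ G *ᵥ γ = γ ⬝ᵥ G *ᵥ w := by
    rw [dotProduct_mulVec, ← mulVec_transpose, hGt, dotProduct_comm]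
  have hadj (x : n → ℝ) : u ⬝ᵥ A *ᵥ x = w ⬝ᵥ x := by
    rw [dotProduct_mulVec, hw, mulVec_transpose]
  have hPu : P *ᵥ u = (A * G) *ᵥ γ := by
    rw [hu, mulVec_mulVec, mul_nonsing_inv _ ((isUnit_iff_isUnit_det P).1 hP.isUnit), one_mulVec]
  have hlhs : γ ⬝ᵥ ((G * Aᵀ) * P⁻¹ * (A * G)) *ᵥ γ = γ ⬝ᵥ G *ᵥ w := by
    simp only [hw, hu, mulVec_mulVec, Matrix.mul_assoc]
  have henergy : u ⬝ᵥ u + c⁻¹ * (w ⬝ᵥ G *ᵥ w) = γ ⬝ᵥ G *ᵥ w := by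
    have h := congrArg (u ⬝ᵥ ·) hPu
    simp only [hPdef, add_mulVec, one_mulVec, smul_mulVec, dotProduct_add, dotProduct_smul,
      ← mulVec_mulVec, hadj, smul_eq_mul] at h
    rw [← hw, hsymm] at h
    exact h
  have hnonneg := hG.dotProduct_mulVec_nonneg (c • γ - w)
  simp only [star_trivial, mulVec_sub, mulVec_smul, dotProduct_sub, sub_dotProduct,
    smul_dotProduct, dotProduct_smul, smul_eq_mul, hsymm] at hnonneg
  have huu : 0 ≤ u ⬝ᵥ u := by simpa using dotProduct_star_self_nonneg u
  have hww : w ⬝ᵥ G *ᵥ w = c * (γ ⬝ᵥ G *ᵥ w) - c * (u ⬝ᵥ u) := by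
    rw [← henergy]; field_simp; ring
  rw [hlhs]
  refine le_of_mul_le_mul_left ?_ hc
  linarith [mul_nonneg hc.le huu]

/-- Let `Z` be a real `T×D` matrix, `K` a real `S×S` symmetric positive semidefinite matrix,
`λ > 0`, `T ≥ 1`, and `W = (I_{TS} + (λT)⁻¹ (ZZᵀ) ⊗ K)⁻¹`. Then for every `γ ∈ ℝ^{SD}`,
`γᵀ (Zᵀ ⊗ K) W (Z ⊗ K) γ ≤ λT · γᵀ (I_D ⊗ K) γ`. -/
theorem stmt_10 {T D S : ℕ} (hT : 1 ≤ T) (Z : Matrix (Fin T) (Fin D) ℝ)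
    (K : Matrix (Fin S) (Fin S) ℝ) (hK : K.PosSemidef) (lam : ℝ) (hlam : 0 < lam)
    (W : Matrix (Fin T × Fin S) (Fin T × Fin S) ℝ)
    (hW : W = ((1 : Matrix (Fin T × Fin S) (Fin T × Fin S) ℝ)
        + (lam * (T : ℝ))⁻¹ • ((Z * Zᵀ) ⊗ₖ K))⁻¹)
    (γ : Fin D × Fin S → ℝ) :
    γ ⬝ᵥ ((Zᵀ ⊗ₖ K) * W * (Z ⊗ₖ K)).mulVec γ ≤
      lam * (T : ℝ) * (γ ⬝ᵥ (((1 : Matrix (Fin D) (Fin D) ℝ) ⊗ₖ K).mulVec γ)) := by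
  have hc : 0 < lam * (T : ℝ) := mul_pos hlam (by exact_mod_cast hT)
  have h := dotProduct_regularized_inv_le (Z ⊗ₖ (1 : Matrix (Fin S) (Fin S) ℝ))
    ((PosSemidef.one (n := Fin D) (R := ℝ)).kronecker hK) hc γ
  rw [← kroneckerMap_transpose] at h
  simp only [transpose_one, ← mul_kronecker_mul, Matrix.mul_one, Matrix.one_mul] at h
  rwa [hW]
end

section
/- For every real c > 0, every real r ≥ 0, and all positive integers M and N, the following sandwich holds: Σ_{i=1}^{min(M,N)} 1/(1 + c·i^{2r}) ≤ Σ_{i=1}^{M} Σ_{j=1}^{N} 1/(1 + c·(i·j)^{r}) ≤ 2·max(M,N) · Σ_{i=1}^{max(M,N)} 1/(1 + c·i^{2r}). -/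
theorem one_div_one_add_mul_rpow_nonneg {c x : ℝ} (hc : 0 < c) (hx : 0 ≤ x) (s : ℝ) :
    0 ≤ 1 / (1 + c * x ^ s) := by
  positivity

theorem rpow_two_mul_eq_mul_self_rpow {x : ℝ} (hx : 0 ≤ x) (r : ℝ) :
    x ^ (2 * r) = (x * x) ^ r := by
  rw [Real.rpow_mul hx, Real.rpow_two, sq]

theorem one_div_one_add_mul_rpow_le_of_le {c r x y : ℝ} (hc : 0 < c) (hr : 0 ≤ r)
    (hx : 0 ≤ x) (hxy : x ≤ y) :
    1 / (1 + c * (x * y) ^ r) ≤ 1 / (1 + c * x ^ (2 * r)) := by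
  rw [rpow_two_mul_eq_mul_self_rpow hx]
  have h : (x * x) ^ r ≤ (x * y) ^ r := by gcongr
  gcongr

theorem one_div_one_add_mul_rpow_le_add {c r x y : ℝ} (hc : 0 < c) (hr : 0 ≤ r)
    (hx : 0 ≤ x) (hy : 0 ≤ y) :
    1 / (1 + c * (x * y) ^ r) ≤ 1 / (1 + c * x ^ (2 * r)) + 1 / (1 + c * y ^ (2 * r)) := by
  have hx' := one_div_one_add_mul_rpow_nonneg hc hx (2 * r)
  have hy' := one_div_one_add_mul_rpow_nonneg hc hy (2 * r)
  rcases le_total x y with h | h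
  · linarith [one_div_one_add_mul_rpow_le_of_le hc hr hx h]
  · rw [mul_comm x y]
    linarith [one_div_one_add_mul_rpow_le_of_le hc hr hy h]


/-- For every real `c > 0`, every real `r ≥ 0`, and all positive integers `M`, `N`:
`Σ_{i=1}^{min(M,N)} 1/(1 + c i^{2r}) ≤ Σ_{i=1}^{M} Σ_{j=1}^{N} 1/(1 + c (ij)^r)
  ≤ 2 max(M,N) Σ_{i=1}^{max(M,N)} 1/(1 + c i^{2r})`. -/
theorem stmt_13 (c r : ℝ) (hc : 0 < c) (hr : 0 ≤ r) (M N : ℕ) (hM : 0 < M) (hN : 0 < N) :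
    (∑ i ∈ Finset.Icc 1 (min M N), 1 / (1 + c * (i : ℝ) ^ (2 * r)) ≤
        ∑ i ∈ Finset.Icc 1 M, ∑ j ∈ Finset.Icc 1 N,
          1 / (1 + c * ((i : ℝ) * (j : ℝ)) ^ r)) ∧
      (∑ i ∈ Finset.Icc 1 M, ∑ j ∈ Finset.Icc 1 N,
          1 / (1 + c * ((i : ℝ) * (j : ℝ)) ^ r) ≤
        2 * (max M N : ℝ) * ∑ i ∈ Finset.Icc 1 (max M N), 1 / (1 + c * (i : ℝ) ^ (2 * r))) := by
  have hnonneg (i j : ℕ) : 0 ≤ 1 / (1 + c * ((i : ℝ) * (j : ℝ)) ^ r) :=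
    one_div_one_add_mul_rpow_nonneg hc (by positivity) r
  constructor
  · calc
      _ ≤ ∑ i ∈ Finset.Icc 1 (min M N), ∑ j ∈ Finset.Icc 1 N,
          1 / (1 + c * ((i : ℝ) * (j : ℝ)) ^ r) := by
        refine Finset.sum_le_sum fun i hi => ?_
        rw [rpow_two_mul_eq_mul_self_rpow i.cast_nonneg]
        refine Finset.single_le_sum (f := fun j : ℕ => 1 / (1 + c * ((i : ℝ) * (j : ℝ)) ^ r))
          (fun j _ => hnonneg i j) ?_
        rw [Finset.mem_Icc] at hi ⊢
        omega
      _ ≤ _ := Finset.sum_le_sum_of_subset_of_nonneg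
        (Finset.Icc_subset_Icc_right (min_le_left M N))
        fun i _ _ => Finset.sum_nonneg fun j _ => hnonneg i j
  · calc
      _ ≤ ∑ i ∈ Finset.Icc 1 (max M N), ∑ j ∈ Finset.Icc 1 N,
          1 / (1 + c * ((i : ℝ) * (j : ℝ)) ^ r) :=
        Finset.sum_le_sum_of_subset_of_nonneg (Finset.Icc_subset_Icc_right (le_max_left M N))
          fun i _ _ => Finset.sum_nonneg fun j _ => hnonneg i j
      _ ≤ ∑ i ∈ Finset.Icc 1 (max M N), ∑ j ∈ Finset.Icc 1 (max M N),
          1 / (1 + c * ((i : ℝ) * (j : ℝ)) ^ r) :=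
        Finset.sum_le_sum fun i _ => Finset.sum_le_sum_of_subset_of_nonneg
          (Finset.Icc_subset_Icc_right (le_max_right M N)) fun j _ _ => hnonneg i j
      _ ≤ ∑ i ∈ Finset.Icc 1 (max M N), ∑ j ∈ Finset.Icc 1 (max M N),
          (1 / (1 + c * (i : ℝ) ^ (2 * r)) + 1 / (1 + c * (j : ℝ) ^ (2 * r))) :=
        Finset.sum_le_sum fun i _ => Finset.sum_le_sum fun j _ =>
          one_div_one_add_mul_rpow_le_add hc hr i.cast_nonneg j.cast_nonneg
      _ = _ := by
        simp only [Finset.sum_add_distrib, Finset.sum_const, Nat.card_Icc, nsmul_eq_mul,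
          Nat.add_sub_cancel, ← Finset.mul_sum, Nat.cast_max]
        ring
end

section
/- Let X be a real T×S matrix, Z a real T×D matrix such that ZᵀZ is positive definite, K a real S×S symmetric positive semidefinite matrix, and λ > 0. Set W = (I_{TS} + (1/(λT))·(ZZᵀ) ⊗ K)⁻¹ and X̃ = X ⊗ I_S (a TS × S² matrix). Then the smallest eigenvalue of the symmetric S²×S² matrix (1/T)·X̃ᵀ W X̃ is at least the smallest eigenvalue of the Schur complement XᵀX/T − (XᵀZ/T)·(ZᵀZ/T)⁻¹·(ZᵀX/T). -/
open Matrix Kronecker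

theorem posSemidef_sub_smul_one_iff {n : Type*} [Fintype n] [DecidableEq n]
    {A : Matrix n n ℝ} (hA : A.IsHermitian) (r : ℝ) :
    (A - r • (1 : Matrix n n ℝ)).PosSemidef ↔ ∀ i, r ≤ hA.eigenvalues i := by
  have hH : (A - r • (1 : Matrix n n ℝ)).IsHermitian :=
    hA.sub (by simp [Matrix.IsHermitian])
  rw [Matrix.posSemidef_iff_isHermitian_and_spectrum_nonneg, ← Algebra.algebraMap_eq_smul_one,
    ← spectrum.sub_singleton_eq, hA.spectrum_real_eq_range_eigenvalues]
  rw [← Algebra.algebraMap_eq_smul_one] at hH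
  rw [and_iff_right hH]
  simp [Set.subset_def]

/-- A positive semidefinite matrix that acts as the identity on the range of an orthogonal
projection dominates that projection. -/
theorem posSemidef_sub_of_mul_eq {n : Type*} [Fintype n] [DecidableEq n]
    {W Q : Matrix n n ℝ} (hW : W.PosSemidef) (hQ : Q.IsHermitian) (hQQ : Q * Q = Q)
    (hQW : Q * W = Q) (hWQ : W * Q = Q) : (W - Q).PosSemidef := by
  have h := hW.conjTranspose_mul_mul_same (1 - Q)
  rw [conjTranspose_sub, conjTranspose_one, hQ.eq] at h
  convert h using 1
  simp only [sub_mul, mul_sub, one_mul, mul_one, hQW, hWQ, hQQ]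
  abel

/-- The inverse of `1 + c (ZZᵀ) ⊗ K` dominates `Q ⊗ 1` for every orthogonal projection `Q`
that annihilates `Z`. -/
theorem posSemidef_inv_one_add_smul_kronecker_sub {m d s : Type*} [Fintype m] [DecidableEq m]
    [Fintype d] [Fintype s] [DecidableEq s] {Z : Matrix m d ℝ} {K : Matrix s s ℝ}
    (hK : K.PosSemidef) {c : ℝ} (hc : 0 ≤ c) {Q : Matrix m m ℝ} (hQ : Q.IsHermitian)
    (hQQ : Q * Q = Q) (hQZ : Q * Z = 0) :
    ((1 + c • ((Z * Zᵀ) ⊗ₖ K))⁻¹ - Q ⊗ₖ (1 : Matrix s s ℝ)).PosSemidef := by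
  set N : Matrix (m × s) (m × s) ℝ := 1 + c • ((Z * Zᵀ) ⊗ₖ K) with hN
  have hZZ : (Z * Zᵀ).PosSemidef := by simpa using posSemidef_self_mul_conjTranspose Z
  have hNpos : N.PosDef := PosDef.one.add_posSemidef ((hZZ.kronecker hK).smul hc)
  have hdet : IsUnit N.det := (isUnit_iff_isUnit_det N).1 hNpos.isUnit
  have hZQ : Zᵀ * Q = 0 := by
    have h := congrArg transpose hQZ
    rwa [transpose_mul, transpose_zero, show Qᵀ = Q from hQ.eq] at h
  have hQN : Q ⊗ₖ (1 : Matrix s s ℝ) * N = Q ⊗ₖ 1 := by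
    rw [hN, mul_add, mul_one, mul_smul_comm, ← mul_kronecker_mul, ← Matrix.mul_assoc, hQZ]
    simp
  have hNQ : N * Q ⊗ₖ (1 : Matrix s s ℝ) = Q ⊗ₖ 1 := by
    rw [hN, add_mul, one_mul, smul_mul_assoc, ← mul_kronecker_mul, Matrix.mul_assoc, hZQ]
    simp
  refine posSemidef_sub_of_mul_eq hNpos.inv.posSemidef ?_ ?_ ?_ ?_
  · rw [Matrix.IsHermitian, conjTranspose_kronecker, hQ.eq, conjTranspose_one]
  · rw [← mul_kronecker_mul, hQQ, one_mul]
  · conv_lhs => rw [← hQN]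
    rw [Matrix.mul_assoc, mul_nonsing_inv N hdet, mul_one]
  · conv_lhs => rw [← hNQ]
    rw [← Matrix.mul_assoc, nonsing_inv_mul N hdet, one_mul]

/-- Let `X` be a real `T×S` matrix, `Z` a real `T×D` matrix with `ZᵀZ` positive definite,
`K` a real `S×S` symmetric positive semidefinite matrix, `λ > 0`, and set
`W = (I_{TS} + (λT)⁻¹ (ZZᵀ) ⊗ K)⁻¹` and `X̃ = X ⊗ I_S`. Then the smallest eigenvalue of the
symmetric `S²×S²` matrix `(1/T) X̃ᵀ W X̃` is at least the smallest eigenvalue of the Schur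
complement `XᵀX/T − (XᵀZ/T)(ZᵀZ/T)⁻¹(ZᵀX/T)`. -/
theorem stmt_17 {T D S : ℕ} [NeZero S] (hT : 1 ≤ T)
    (X : Matrix (Fin T) (Fin S) ℝ) (Z : Matrix (Fin T) (Fin D) ℝ)
    (hZ : (Zᵀ * Z).PosDef)
    (K : Matrix (Fin S) (Fin S) ℝ) (hK : K.PosSemidef) (lam : ℝ) (hlam : 0 < lam)
    (W : Matrix (Fin T × Fin S) (Fin T × Fin S) ℝ)
    (hW : W = ((1 : Matrix (Fin T × Fin S) (Fin T × Fin S) ℝ)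
        + (lam * (T : ℝ))⁻¹ • ((Z * Zᵀ) ⊗ₖ K))⁻¹)
    (Xt : Matrix (Fin T × Fin S) (Fin S × Fin S) ℝ)
    (hXt : Xt = X ⊗ₖ (1 : Matrix (Fin S) (Fin S) ℝ))
    (hM : ((T : ℝ)⁻¹ • (Xtᵀ * W * Xt)).IsHermitian)
    (hSchur : ((T : ℝ)⁻¹ • (Xᵀ * X)
        - ((T : ℝ)⁻¹ • (Xᵀ * Z)) * ((T : ℝ)⁻¹ • (Zᵀ * Z))⁻¹
            * ((T : ℝ)⁻¹ • (Zᵀ * X))).IsHermitian) :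
    (⨅ i, hSchur.eigenvalues i) ≤ ⨅ p, hM.eigenvalues p := by
  have hT0 : (0 : ℝ) < T := by exact_mod_cast hT
  have hdet : IsUnit (Zᵀ * Z).det := (isUnit_iff_isUnit_det _).1 hZ.isUnit
  have hGt : (Zᵀ * Z)⁻¹ᵀ = (Zᵀ * Z)⁻¹ := by
    rw [transpose_nonsing_inv, transpose_mul, transpose_transpose]
  set G := (Zᵀ * Z)⁻¹
  have hQZ : (1 - Z * G * Zᵀ) * Z = 0 := by
    rw [Matrix.sub_mul, Matrix.one_mul, Matrix.mul_assoc, Matrix.mul_assoc,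
      nonsing_inv_mul _ hdet, Matrix.mul_one, sub_self]
  have hQ : (1 - Z * G * Zᵀ).IsHermitian := by
    simp [Matrix.IsHermitian, hGt, Matrix.mul_assoc]
  have hQQ : (1 - Z * G * Zᵀ) * (1 - Z * G * Zᵀ) = 1 - Z * G * Zᵀ := by
    rw [Matrix.mul_sub, Matrix.mul_one, ← Matrix.mul_assoc, ← Matrix.mul_assoc, hQZ,
      Matrix.zero_mul, Matrix.zero_mul, sub_zero]
  have hinv : ((T : ℝ)⁻¹ • (Zᵀ * Z))⁻¹ = (T : ℝ) • G := by
    refine inv_eq_left_inv ?_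
    rw [smul_mul_smul_comm, mul_inv_cancel₀ hT0.ne', nonsing_inv_mul _ hdet, one_smul]
  have hSchurEq : (T : ℝ)⁻¹ • (Xᵀ * X)
        - ((T : ℝ)⁻¹ • (Xᵀ * Z)) * ((T : ℝ)⁻¹ • (Zᵀ * Z))⁻¹ * ((T : ℝ)⁻¹ • (Zᵀ * X))
      = (T : ℝ)⁻¹ • (Xᵀ * (1 - Z * G * Zᵀ) * X) := by
    rw [hinv, Matrix.mul_smul, Matrix.smul_mul, Matrix.mul_smul, Matrix.smul_mul, Matrix.smul_mul,
      smul_smul _ (T : ℝ), inv_mul_cancel₀ hT0.ne', one_smul, ← smul_sub]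
    simp only [Matrix.mul_sub, Matrix.sub_mul, Matrix.mul_one, Matrix.mul_assoc]
  set r := ⨅ i, hSchur.eigenvalues i
  have hSr := (posSemidef_sub_smul_one_iff hSchur r).2
    fun i => ciInf_le (Set.finite_range _).bddBelow i
  have hWQ := posSemidef_inv_one_add_smul_kronecker_sub (Z := Z) hK
    (inv_nonneg.2 (mul_pos hlam hT0).le) hQ hQQ hQZ
  refine le_ciInf ((posSemidef_sub_smul_one_iff hM r).1 ?_)
  have hsum := ((hWQ.conjTranspose_mul_mul_same Xt).smul (inv_nonneg.2 hT0.le)).add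
    (hSr.kronecker (PosSemidef.one (n := Fin S) (R := ℝ)))
  convert hsum using 1
  have hXQX : Xtᵀ * (1 - Z * G * Zᵀ) ⊗ₖ (1 : Matrix (Fin S) (Fin S) ℝ) * Xt
      = (Xᵀ * (1 - Z * G * Zᵀ) * X) ⊗ₖ 1 := by
    rw [hXt, ← kroneckerMap_transpose, ← mul_kronecker_mul, ← mul_kronecker_mul]
    simp
  have hkron (A B : Matrix (Fin S) (Fin S) ℝ) :
      (A - B) ⊗ₖ (1 : Matrix (Fin S) (Fin S) ℝ) = A ⊗ₖ 1 - B ⊗ₖ 1 := by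
    rw [sub_eq_add_neg, add_kronecker, ← neg_one_smul ℝ B, smul_kronecker, neg_one_smul,
      sub_eq_add_neg]
  rw [hSchurEq, ← hW, conjTranspose_eq_transpose_of_trivial, Matrix.mul_sub, Matrix.sub_mul, hXQX,
    smul_sub, hkron, smul_kronecker, smul_kronecker, one_kronecker_one]
  abel
end

section
/- Let K and Σ be real S×S symmetric positive definite matrices, λ > 0, T ≥ 1, and let z₁, …, z_T ∈ ℝ^D and x₁, …, x_T ∈ ℝ^S. Define the objective f(γ) = (1/(2T)) Σ_{t=1}^{T} (x_t − (z_tᵀ ⊗ K)γ)ᵀ Σ⁻¹ (x_t − (z_tᵀ ⊗ K)γ) + (λ/2)·γᵀ(I_D ⊗ K)γ for γ ∈ ℝ^{SD}. Then the matrix (Σ_{t=1}^{T} z_t z_tᵀ) ⊗ K + λT·(I_D ⊗ Σ) is invertible and f attains its unique global minimum at γ̂ = [(Σ_{t=1}^{T} z_t z_tᵀ) ⊗ K + λT·(I_D ⊗ Σ)]⁻¹ · (Σ_{t=1}^{T} z_t ⊗ x_t). -/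
open Matrix Kronecker

namespace Matrix

lemma PosDef.one_kronecker {m n : Type*} [Fintype m] [DecidableEq m] [Fintype n] [DecidableEq n]
    {K : Matrix n n ℝ} (hK : K.PosDef) : ((1 : Matrix m m ℝ) ⊗ₖ K).PosDef :=
  PosDef.one.kronecker hK

lemma IsSymm.dotProduct_mulVec_add {n : Type*} [Fintype n] {W : Matrix n n ℝ} (hW : W.IsSymm)
    (a b : n → ℝ) :
    (a + b) ⬝ᵥ (W *ᵥ (a + b)) = a ⬝ᵥ (W *ᵥ a) + 2 * (b ⬝ᵥ (W *ᵥ a)) + b ⬝ᵥ (W *ᵥ b) := by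
  have h : a ⬝ᵥ (W *ᵥ b) = b ⬝ᵥ (W *ᵥ a) := by
    rw [dotProduct_mulVec, ← mulVec_transpose, hW.eq, dotProduct_comm]
  rw [mulVec_add, dotProduct_add, add_dotProduct, add_dotProduct, h]
  ring

/-- A stationary point of a regularized weighted least squares objective is its strict global
minimizer. -/
lemma regularized_leastSquares_lt {ι m n : Type*} [Fintype ι] [Fintype m] [Fintype n]
    {W : Matrix m m ℝ} (hW : W.PosSemidef) {Q : Matrix n n ℝ} (hQ : Q.PosDef)
    (M : ι → Matrix m n ℝ) (x : ι → m → ℝ) {c d : ℝ} (hc : 0 ≤ c) (hd : 0 < d) {γ₀ γ : n → ℝ}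
    (hγ₀ : c • ∑ t, (M t)ᵀ *ᵥ (W *ᵥ (x t - M t *ᵥ γ₀)) = d • (Q *ᵥ γ₀)) (hγ : γ ≠ γ₀) :
    c * ∑ t, (x t - M t *ᵥ γ₀) ⬝ᵥ (W *ᵥ (x t - M t *ᵥ γ₀)) + d * (γ₀ ⬝ᵥ (Q *ᵥ γ₀)) <
      c * ∑ t, (x t - M t *ᵥ γ) ⬝ᵥ (W *ᵥ (x t - M t *ᵥ γ)) + d * (γ ⬝ᵥ (Q *ᵥ γ)) := by
  obtain ⟨h, rfl⟩ : ∃ h, γ = γ₀ + h := ⟨γ - γ₀, by simp⟩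
  have hh : h ≠ 0 := by simpa using hγ
  have hWs : W.IsSymm := by simpa [IsHermitian, IsSymm] using hW.isHermitian
  have hQs : Q.IsSymm := by simpa [IsHermitian, IsSymm] using hQ.isHermitian
  have hres (t : ι) : x t - M t *ᵥ (γ₀ + h) = (x t - M t *ᵥ γ₀) + -(M t *ᵥ h) := by
    rw [mulVec_add]; abel
  have hadj (t : ι) (v : m → ℝ) : (M t *ᵥ h) ⬝ᵥ v = h ⬝ᵥ ((M t)ᵀ *ᵥ v) := by
    rw [mulVec_transpose, dotProduct_comm, dotProduct_mulVec, dotProduct_comm]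
  have hlin : c * ∑ t, (M t *ᵥ h) ⬝ᵥ (W *ᵥ (x t - M t *ᵥ γ₀)) = d * (h ⬝ᵥ (Q *ᵥ γ₀)) := by
    simp_rw [hadj]
    rw [← dotProduct_sum, ← smul_eq_mul, ← dotProduct_smul, hγ₀, dotProduct_smul, smul_eq_mul]
  have hquad : 0 ≤ c * ∑ t, (M t *ᵥ h) ⬝ᵥ (W *ᵥ (M t *ᵥ h)) :=
    mul_nonneg hc <| Finset.sum_nonneg fun t _ => by
      simpa using hW.dotProduct_mulVec_nonneg (M t *ᵥ h)
  have hpos : 0 < d * (h ⬝ᵥ (Q *ᵥ h)) :=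
    mul_pos hd (by simpa using hQ.dotProduct_mulVec_pos hh)
  simp_rw [hres, hWs.dotProduct_mulVec_add, hQs.dotProduct_mulVec_add, mulVec_neg,
    neg_dotProduct_neg, neg_dotProduct, Finset.sum_add_distrib, ← Finset.mul_sum,
    Finset.sum_neg_distrib]
  linarith

variable {m n R : Type*} [Fintype m] [Fintype n] [CommRing R]

lemma transpose_of_mul_mulVec [DecidableEq m] (z : m → R) {K : Matrix n n R} (hK : K.IsSymm)
    (W : Matrix n n R) (v : n → R) :
    (of fun s (p : m × n) => z p.1 * K s p.2)ᵀ *ᵥ (W *ᵥ v) =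
      ((1 : Matrix m m R) ⊗ₖ (K * W)) *ᵥ fun p => z p.1 * v p.2 := by
  ext ⟨i, s⟩
  have h : (K *ᵥ (W *ᵥ v)) s = ((K * W) *ᵥ v) s := by rw [mulVec_mulVec]
  simp only [mulVec, dotProduct, transpose_apply, of_apply, Fintype.sum_prod_type,
    kroneckerMap_apply, one_apply, ite_mul, one_mul, zero_mul, Finset.sum_ite_irrel,
    Finset.sum_const_zero, Finset.sum_ite_eq, Finset.mem_univ, if_true] at h ⊢
  simp_rw [hK.apply s, mul_assoc, mul_left_comm _ (z i), ← Finset.mul_sum, h]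

lemma vecMulVec_self_kronecker_mulVec (z : m → R) (K : Matrix n n R) (γ : m × n → R) :
    (vecMulVec z z ⊗ₖ K) *ᵥ γ =
      fun p => z p.1 * ((of fun s (p : m × n) => z p.1 * K s p.2) *ᵥ γ) p.2 := by
  ext p
  simp only [mulVec, dotProduct, of_apply, kroneckerMap_apply, vecMulVec_apply, Finset.mul_sum,
    mul_assoc]

end Matrix

/-- Kernel ridge regression updating formula. Let `K` and `Σ` be real `S×S` symmetric positive
definite matrices, `λ > 0`, `T ≥ 1`, and `z_1,…,z_T ∈ ℝ^D`, `x_1,…,x_T ∈ ℝ^S`. With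
`f(γ) = (1/(2T)) Σ_t (x_t − (z_tᵀ ⊗ K)γ)ᵀ Σ⁻¹ (x_t − (z_tᵀ ⊗ K)γ) + (λ/2) γᵀ(I_D ⊗ K)γ`,
the matrix `(Σ_t z_t z_tᵀ) ⊗ K + λT (I_D ⊗ Σ)` is invertible and `f` attains its unique global
minimum at `γ̂ = [(Σ_t z_t z_tᵀ) ⊗ K + λT (I_D ⊗ Σ)]⁻¹ (Σ_t z_t ⊗ x_t)`. -/
theorem stmt_19 {S D T : ℕ} (hT : 1 ≤ T)
    (K Sig : Matrix (Fin S) (Fin S) ℝ) (hK : K.PosDef) (hSig : Sig.PosDef)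
    (lam : ℝ) (hlam : 0 < lam)
    (z : Fin T → Fin D → ℝ) (x : Fin T → Fin S → ℝ)
    (f : (Fin D × Fin S → ℝ) → ℝ)
    (hf : f = fun γ =>
      (1 / (2 * (T : ℝ))) *
          ∑ t : Fin T,
            (x t - (Matrix.of fun s p => z t p.1 * K s p.2).mulVec γ) ⬝ᵥ
              (Sig⁻¹.mulVec (x t - (Matrix.of fun s p => z t p.1 * K s p.2).mulVec γ))
        + (lam / 2) * (γ ⬝ᵥ (((1 : Matrix (Fin D) (Fin D) ℝ) ⊗ₖ K).mulVec γ)))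
    (A : Matrix (Fin D × Fin S) (Fin D × Fin S) ℝ)
    (hA : A = (∑ t : Fin T, Matrix.vecMulVec (z t) (z t)) ⊗ₖ K
        + (lam * (T : ℝ)) • ((1 : Matrix (Fin D) (Fin D) ℝ) ⊗ₖ Sig))
    (γhat : Fin D × Fin S → ℝ)
    (hγhat : γhat = A⁻¹.mulVec (∑ t : Fin T, fun p => z t p.1 * x t p.2)) :
    IsUnit A ∧ ∀ γ : Fin D × Fin S → ℝ, γ ≠ γhat → f γhat < f γ := by
  have hT' : (0 : ℝ) < T := by exact_mod_cast hT
  have hApd : A.PosDef := by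
    rw [hA]
    refine PosDef.posSemidef_add (PosSemidef.kronecker ?_ hK.posSemidef)
      (hSig.one_kronecker.smul (mul_pos hlam hT'))
    exact posSemidef_sum _ fun t _ => by simpa using posSemidef_vecMulVec_self_star (z t)
  refine ⟨hApd.isUnit, fun γ hγ => ?_⟩
  have hKs : K.IsSymm := by simpa [IsHermitian, IsSymm] using hK.isHermitian
  have hnormal : A *ᵥ γhat = ∑ t : Fin T, fun p => z t p.1 * x t p.2 := by
    rw [hγhat, mulVec_mulVec, mul_nonsing_inv _ ((isUnit_iff_isUnit_det A).mp hApd.isUnit),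
      one_mulVec]
  have hresid : ∑ t : Fin T, (fun p : Fin D × Fin S => z t p.1 *
      (x t - (of fun s p => z t p.1 * K s p.2) *ᵥ γhat) p.2) =
      (lam * (T : ℝ)) • (((1 : Matrix (Fin D) (Fin D) ℝ) ⊗ₖ Sig) *ᵥ γhat) := by
    have hgram : (∑ t, vecMulVec (z t) (z t)) ⊗ₖ K = ∑ t, vecMulVec (z t) (z t) ⊗ₖ K := by
      ext p q
      simp [Matrix.sum_apply, Finset.sum_mul]
    rw [hA, add_mulVec, smul_mulVec, hgram, sum_mulVec] at hnormal
    rw [← sub_eq_of_eq_add' hnormal.symm, ← Finset.sum_sub_distrib]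
    refine Finset.sum_congr rfl fun t _ => ?_
    rw [vecMulVec_self_kronecker_mulVec]
    ext p
    simp [mul_sub]
  have hSinv : K * Sig⁻¹ * Sig = K := by
    rw [Matrix.mul_assoc, nonsing_inv_mul _ ((isUnit_iff_isUnit_det Sig).mp hSig.isUnit),
      Matrix.mul_one]
  rw [hf]
  refine regularized_leastSquares_lt hSig.inv.posSemidef hK.one_kronecker
    (fun t => of fun s p => z t p.1 * K s p.2) x (by positivity) (by positivity) ?_ hγ
  simp_rw [transpose_of_mul_mulVec _ hKs]
  rw [← mulVec_sum, hresid, mulVec_smul, mulVec_mulVec, ← mul_kronecker_mul, hSinv, one_mul,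
    smul_smul]
  congr 1
  field_simp
end
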